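/- Every tree with at least two vertices is 2-word-representable. -/

import Mathlib

/-- Two letters `x` and `y` alternate in the word `w` if, after deleting all letters
other than `x` and `y`, no two equal letters are consecutive. -/
def Alternate {V : Type*} [DecidableEq V] (w : List V) (x y : V) : Prop :=
  (w.filter (fun z => decide (z = x ∨ z = y))).Chain' (· ≠ ·)

/-- A word `w` represents the graph `G` if every vertex occurs in `w` and two distinct
vertices alternate in `w` exactly when they are adjacent in `G`. -/
def Represents {V : Type*} [DecidableEq V] (w : List V) (G : SimpleGraph V) : Prop :=
  (∀ v : V, v ∈ w) ∧ ∀ x y : V, x ≠ y → (Alternate w x y ↔ G.Adj x y)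

/-- A graph is word-representable if some word represents it. -/
def WordRepresentable {V : Type*} [DecidableEq V] (G : SimpleGraph V) : Prop :=
  ∃ w : List V, Represents w G

/-- A word is `k`-uniform if every letter occurs in it exactly `k` times. -/
def KUniform {V : Type*} [DecidableEq V] (k : ℕ) (w : List V) : Prop :=
  ∀ v : V, w.count v = k

/-- A graph is `k`-word-representable if some `k`-uniform word represents it. -/
def KRepresentable {V : Type*} [DecidableEq V] (G : SimpleGraph V) (k : ℕ) : Prop :=
  ∃ w : List V, KUniform k w ∧ Represents w G

/-- The representation number of a graph: the least `k` such that it is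
`k`-word-representable. -/
noncomputable def reprNum {V : Type*} [DecidableEq V] (G : SimpleGraph V) : ℕ :=
  sInf {k | KRepresentable G k}

lemma Alternate.symm {V : Type*} [DecidableEq V] {w : List V} {x y : V}
    (h : Alternate w x y) : Alternate w y x := by
  simpa only [Alternate, or_comm] using h

lemma alternate_comm {V : Type*} [DecidableEq V] {w : List V} {x y : V} :
    Alternate w x y ↔ Alternate w y x :=
  ⟨Alternate.symm, Alternate.symm⟩

lemma alternate_map_iff {V W : Type*} [DecidableEq V] [DecidableEq W] {f : V → W}
    (hf : Function.Injective f) (w : List V) (x y : V) :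
    Alternate (w.map f) (f x) (f y) ↔ Alternate w x y := by
  simp [Alternate, List.filter_map, List.Chain', List.isChain_map, hf.eq_iff,
    Function.comp_def]

/-- Surrounding one occurrence of a letter by two copies of `v` does not affect the
alternation of letters other than `v`. -/
lemma alternate_surround_iff {V : Type*} [DecidableEq V] {v x y : V} (hx : v ≠ x) (hy : v ≠ y)
    (u : V) (A B : List V) :
    Alternate (A ++ v :: u :: v :: B) x y ↔ Alternate (A ++ u :: B) x y := by
  simp [Alternate, List.filter_cons, hx, hy]

lemma not_alternate_surround {V : Type*} [DecidableEq V] {u v x : V} (hvu : u ≠ v) (hxu : u ≠ x)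
    (A B : List V) : ¬ Alternate (A ++ v :: u :: v :: B) v x := by
  simp [Alternate, List.Chain', hvu, hxu, List.isChain_append]

lemma alternate_surround_self {V : Type*} [DecidableEq V] {u v : V} (hvu : u ≠ v)
    {A B : List V} (huA : u ∉ A) (hvA : v ∉ A) (hvB : v ∉ B) (huB : B.count u = 1) :
    Alternate (A ++ v :: u :: v :: B) v u := by
  have hA : A.filter (fun z => decide (z = v ∨ z = u)) = [] := by
    simp only [List.filter_eq_nil_iff, decide_eq_true_eq]
    rintro a ha (rfl | rfl) <;> contradiction
  have hB : B.filter (fun z => decide (z = v ∨ z = u)) = [u] := by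
    rw [← List.replicate_one, ← huB, ← List.filter_eq]
    refine List.filter_congr fun z hz => ?_
    have : z ≠ v := fun h => hvB (h ▸ hz)
    simp [this, eq_comm]
  rw [Alternate, List.filter_append, hA]
  simp [List.Chain', -Bool.decide_or, hB, hvu, hvu.symm]

/-- Attaching a leaf preserves 2-word-representability. -/
lemma KRepresentable.two_of_induce_compl_leaf {V : Type*} [DecidableEq V] {G : SimpleGraph V}
    {u v : V} (huv : G.Adj v u) (huniq : ∀ x, G.Adj v x → x = u)
    (h : KRepresentable (G.induce ({v}ᶜ : Set V)) 2) : KRepresentable G 2 := by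
  obtain ⟨w, hunif, -, hw⟩ := h
  have hvu : u ≠ v := huv.ne'
  have hcount (x : V) (hx : x ≠ v) : (w.map Subtype.val).count x = 2 := by
    rw [← hunif ⟨x, hx⟩]
    simp only [List.count, List.countP_map]
    refine List.countP_congr fun y _ => ?_
    simp [Subtype.ext_iff]
  have hv : v ∉ w.map Subtype.val := by simp
  have halt (x y : V) (hx : x ≠ v) (hy : y ≠ v) (hxy : x ≠ y) :
      Alternate (w.map Subtype.val) x y ↔ G.Adj x y :=
    (alternate_map_iff Subtype.val_injective w ⟨x, hx⟩ ⟨y, hy⟩).trans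
      (hw ⟨x, hx⟩ ⟨y, hy⟩ fun h => hxy (congrArg Subtype.val h))
  generalize w.map Subtype.val = w' at hcount hv halt
  have hu : u ∈ w' := List.count_pos_iff.mp (by simp [hcount u hvu])
  obtain ⟨A, B, rfl, huA⟩ := List.eq_append_cons_of_mem hu
  simp only [List.mem_append, List.mem_cons, not_or] at hv
  obtain ⟨hvA, -, hvB⟩ := hv
  have huB : B.count u = 1 := by
    simpa [List.count_eq_zero_of_not_mem huA] using hcount u hvu
  have hunif' : KUniform 2 (A ++ v :: u :: v :: B) := by
    intro x
    rcases eq_or_ne x v with rfl | hx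
    · simp [List.count_eq_zero_of_not_mem hvA, List.count_eq_zero_of_not_mem hvB, hvu]
    · rw [← hcount x hx]
      simp [List.count_cons, hx.symm]
  have hleaf (x : V) (hx : x ≠ v) : Alternate (A ++ v :: u :: v :: B) v x ↔ G.Adj v x := by
    rcases eq_or_ne x u with rfl | hxu
    · exact iff_of_true (alternate_surround_self hvu huA hvA hvB huB) huv
    · exact iff_of_false (not_alternate_surround hvu hxu.symm A B) fun h => hxu (huniq x h)
  refine ⟨_, hunif', fun x => List.count_pos_iff.mp (by simp [hunif' x]), fun x y hxy => ?_⟩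
  rcases eq_or_ne x v with rfl | hx
  · exact hleaf y hxy.symm
  rcases eq_or_ne y v with rfl | hy
  · rw [alternate_comm, G.adj_comm]
    exact hleaf x hx
  · exact (alternate_surround_iff hx.symm hy.symm u A B).trans (halt x y hx hy hxy)

lemma KRepresentable.of_unique {V : Type*} [DecidableEq V] [Unique V] (G : SimpleGraph V)
    {k : ℕ} (hk : k ≠ 0) : KRepresentable G k :=
  ⟨List.replicate k default, fun v => by simp [Unique.eq_default v],
    fun v => by simp [Unique.eq_default v, hk], fun x y hxy => (hxy (Subsingleton.elim x y)).elim⟩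

lemma SimpleGraph.IsTree.kRepresentable_two {V : Type*} [DecidableEq V] [Fintype V]
    {G : SimpleGraph V} (hG : G.IsTree) : KRepresentable G 2 := by
  classical
  induction hn : Fintype.card V generalizing V with
  | zero =>
    have := hG.1.nonempty
    exact (Fintype.card_ne_zero hn).elim
  | succ n ih =>
    rcases subsingleton_or_nontrivial V with hV | hV
    · have := Classical.inhabited_of_nonempty hG.1.nonempty
      have := Unique.mk' V
      exact .of_unique G two_ne_zero
    · obtain ⟨v, hv⟩ := hG.exists_vert_degree_one_of_nontrivial
      obtain ⟨u, hu, huniq⟩ := SimpleGraph.degree_eq_one_iff_existsUnique_adj.mp hv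
      refine .two_of_induce_compl_leaf hu huniq (ih ⟨?_, hG.2.induce _⟩ ?_)
      · exact hG.1.induce_compl_singleton_of_degree_eq_one hv
      · rw [Fintype.card_compl_set, hn]
        simp

/-- Every tree (a connected acyclic graph) with at least two vertices is
2-word-representable. -/
theorem tree_two_word_representable {V : Type*} [DecidableEq V] [Fintype V]
    (G : SimpleGraph V) (htree : G.IsTree) (hcard : 2 ≤ Fintype.card V) :
    KRepresentable G 2 :=
  htree.kRepresentable_two
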